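/- (Negation-gadget lemma.) Let δ be a real number with 0 < δ < 1/4, let b ∈ [1 − 2δ, 1] and w ∈ [−1 − 2δ, −1] be any weights in the gadget's intervals, let χ ∈ {0} ∪ [1 − 2δ, 1], and set y = max(0, b + w·χ). Then: (i) y ∈ [0, 2δ] ∪ [1 − 2δ, 1]; (ii) y ∈ [1 − 2δ, 1] if and only if χ = 0; and (iii) y ∈ [0, 2δ] if and only if χ ∈ [1 − 2δ, 1]. -/

import Mathlib

/-- Negation-gadget lemma: for `0 < δ < 1/4`, bias `b ∈ [1-2δ, 1]`, weight
`w ∈ [-1-2δ, -1]`, and input `χ ∈ {0} ∪ [1-2δ, 1]`, the ReLU output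
`y = max 0 (b + w·χ)` satisfies:
(i) `y ∈ [0, 2δ] ∪ [1-2δ, 1]`;
(ii) `y ∈ [1-2δ, 1] ↔ χ = 0`;
(iii) `y ∈ [0, 2δ] ↔ χ ∈ [1-2δ, 1]`. -/
theorem negation_gadget (δ b w χ : ℝ) (hδ0 : 0 < δ) (hδ : δ < 1/4)
    (hb : b ∈ Set.Icc (1 - 2*δ) 1) (hw : w ∈ Set.Icc (-1 - 2*δ) (-1))
    (hχ : χ ∈ ({0} : Set ℝ) ∪ Set.Icc (1 - 2*δ) 1) :
    (max 0 (b + w * χ) ∈ Set.Icc (0:ℝ) (2*δ) ∪ Set.Icc (1 - 2*δ) 1) ∧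
    (max 0 (b + w * χ) ∈ Set.Icc (1 - 2*δ) 1 ↔ χ = 0) ∧
    (max 0 (b + w * χ) ∈ Set.Icc (0:ℝ) (2*δ) ↔ χ ∈ Set.Icc (1 - 2*δ) 1) := by
  obtain ⟨hb1, hb2⟩ := hb
  obtain ⟨hw1, hw2⟩ := hw
  rcases hχ with h | ⟨h1, h2⟩
  · have h0 : χ = 0 := h
    subst h0
    have hy : max 0 (b + w * 0) = b := by
      rw [mul_zero, add_zero]
      exact max_eq_right (by linarith)
    rw [hy]
    refine ⟨Or.inr ⟨hb1, hb2⟩, ⟨fun _ => rfl, fun _ => ⟨hb1, hb2⟩⟩, ?_, ?_⟩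
    · rintro ⟨_, h⟩
      linarith
    · rintro ⟨h, _⟩
      linarith
  · have hle : b + w * χ ≤ 2 * δ := by nlinarith
    have hy : max 0 (b + w * χ) ∈ Set.Icc (0:ℝ) (2*δ) :=
      ⟨le_max_left _ _, max_le (by linarith) hle⟩
    refine ⟨Or.inl hy, ⟨?_, ?_⟩, fun _ => ⟨h1, h2⟩, fun _ => hy⟩
    · rintro ⟨h, _⟩
      have := hy.2
      linarith
    · intro h
      linarith
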